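/- Let p be a prime, e ≥ 0, G a finite p-group with p^{e+1} dividing |G|, and let I be the intersection of all subgroups of G of order p^{e+1}. Then the number of connected components of the poset Γ_{p,e}(G) is at most |Irr(I)|, the number of irreducible characters of I. In particular, if two irreducible characters α, α' of a fixed subgroup L_0 of order p^{e+1} have restrictions to I sharing a common irreducible constituent, then (L_0, α) and (L_0, α') are connected in Γ_{p,e}(G). -/

import Mathlib

open scoped BigOperators Classical

noncomputable section

/-- Inner product of class functions on a finite group. -/
def charInner (G : Type*) [Group G] [Fintype G] (f g : G → ℂ) : ℂ :=
  (Fintype.card G : ℂ)⁻¹ * ∑ x : G, f x * (starRingEnd ℂ) (g x)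

/-- `χ` is the character of some finite-dimensional complex representation. -/
def IsChar (G : Type*) [Group G] (χ : G → ℂ) : Prop :=
  ∃ (n : ℕ) (ρ : Representation ℂ G (Fin n → ℂ)),
    ∀ g : G, χ g = LinearMap.trace ℂ (Fin n → ℂ) (ρ g)

/-- Irreducible character: a character of norm one. -/
def IsIrrChar (G : Type*) [Group G] [Fintype G] (χ : G → ℂ) : Prop :=
  IsChar G χ ∧ charInner G χ χ = 1

/-- Restriction of a character of `H` to a smaller subgroup `K ≤ H`. -/
def resChar {G : Type*} [Group G] {K H : Subgroup G} (h : K ≤ H) (φ : H → ℂ) :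
    K → ℂ := fun k => φ (Subgroup.inclusion h k)

/-- Induced class function from a subgroup `H` up to `G`. -/
def inducedChar {G : Type*} [Group G] [Fintype G] (H : Subgroup G) (α : H → ℂ) :
    G → ℂ := fun g =>
  (Fintype.card H : ℂ)⁻¹ *
    ∑ x : G, if h : x * g * x⁻¹ ∈ H then α ⟨x * g * x⁻¹, h⟩ else 0

/-- Induced class function from a subgroup `A` up to a larger subgroup `B`. -/
def inducedCharSub {G : Type*} [Group G] [Fintype G] {A B : Subgroup G}
    (_ : A ≤ B) (η : A → ℂ) : B → ℂ := fun b =>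
  (Fintype.card A : ℂ)⁻¹ *
    ∑ x : B, if h : (x : G) * (b : G) * (x : G)⁻¹ ∈ A then η ⟨_, h⟩ else 0
/-- Elements of the poset `Γ_{p,e}(G)`: pairs `(H, φ)` with `|H| ≥ p^(e+1)` and
`φ ∈ Irr(H)`. -/
structure GammaPair (p e : ℕ) (G : Type*) [Group G] [Fintype G] where
  H : Subgroup G
  hH : p ^ (e + 1) ≤ Fintype.card H
  φ : H → ℂ
  hφ : IsIrrChar H φ

/-- The partial order on `Γ_{p,e}(G)`: `(K, ψ) ≤ (H, φ)` iff `K ≤ H` and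
`[φ_K, ψ] ≠ 0`. -/
def GammaLe {p e : ℕ} {G : Type*} [Group G] [Fintype G]
    (a b : GammaPair p e G) : Prop :=
  ∃ h : a.H ≤ b.H, charInner a.H (resChar h b.φ) a.φ ≠ 0

/-- Two elements of `Γ_{p,e}(G)` are connected if joined by a finite zigzag of
comparable pairs. -/
def GammaConnected {p e : ℕ} {G : Type*} [Group G] [Fintype G]
    (a b : GammaPair p e G) : Prop :=
  Relation.EqvGen (fun x y => GammaLe x y ∨ GammaLe y x) a b

/-- The setoid of connectedness on `Γ_{p,e}(G)`; its quotient is `π₀(Γ_{p,e}(G))`. -/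
def gammaSetoid (p e : ℕ) (G : Type*) [Group G] [Fintype G] :
    Setoid (GammaPair p e G) :=
  Relation.EqvGen.setoid (fun x y => GammaLe x y ∨ GammaLe y x)

open Module Representation in
theorem isChar_character {G V : Type*} [Group G] [AddCommGroup V] [Module ℂ V]
    [FiniteDimensional ℂ V] (ρ : Representation ℂ G V) : IsChar G ρ.character := by
  let e : V ≃ₗ[ℂ] (Fin (finrank ℂ V) → ℂ) := (finBasis ℂ V).equivFun
  refine ⟨finrank ℂ V,
    { toFun := fun g => e.conj (ρ g)
      map_one' := by simp [End.one_eq_id]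
      map_mul' := fun g h => by simp [End.mul_eq_comp, LinearEquiv.conj_comp] }, fun g => ?_⟩
  exact (LinearMap.trace_conj' (ρ g) e).symm

theorem resChar_add {G : Type*} [Group G] {L H : Subgroup G} (h : L ≤ H) (f g : H → ℂ) :
    resChar h (f + g) = resChar h f + resChar h g := rfl

namespace IsChar

variable {G : Type*} [Group G]

theorem exists_character_eq {χ : G → ℂ} (h : IsChar G χ) :
    ∃ (n : ℕ) (ρ : Representation ℂ G (Fin n → ℂ)), ρ.character = χ := by
  obtain ⟨n, ρ, hρ⟩ := h
  exact ⟨n, ρ, funext fun g => (hρ g).symm⟩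

theorem zero : IsChar G (0 : G → ℂ) :=
  ⟨0, 1, fun g => by simp [Module.End.one_eq_id]⟩

theorem add {χ ψ : G → ℂ} (hχ : IsChar G χ) (hψ : IsChar G ψ) : IsChar G (χ + ψ) := by
  obtain ⟨n, ρ, rfl⟩ := hχ.exists_character_eq
  obtain ⟨m, σ, rfl⟩ := hψ.exists_character_eq
  convert isChar_character (ρ.prod σ) using 1
  ext g
  exact (LinearMap.trace_prodMap' (ρ g) (σ g)).symm

theorem resChar {K H : Subgroup G} (h : K ≤ H) {χ : H → ℂ} (hχ : IsChar H χ) :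
    IsChar K (resChar h χ) := by
  obtain ⟨n, ρ, hρ⟩ := hχ
  exact ⟨n, ρ.comp (Subgroup.inclusion h), fun g => hρ _⟩

theorem exists_nat_one {χ : G → ℂ} (hχ : IsChar G χ) : ∃ n : ℕ, χ 1 = n := by
  obtain ⟨n, ρ, rfl⟩ := hχ.exists_character_eq
  exact ⟨_, ρ.char_one⟩

theorem eq_zero_of_apply_one {χ : G → ℂ} (hχ : IsChar G χ) (h : χ 1 = 0) : χ = 0 := by
  obtain ⟨n, ρ, rfl⟩ := hχ.exists_character_eq
  have : n = 0 := by simpa using h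
  subst this
  ext g
  simp [Representation.character, Subsingleton.elim (ρ g) 0]

end IsChar

/-- The character of the regular representation. -/
def regChar (G : Type*) [Group G] [Fintype G] : G → ℂ :=
  fun g => if g = 1 then (Fintype.card G : ℂ) else 0

theorem isChar_regChar (G : Type*) [Group G] [Fintype G] : IsChar G (regChar G) := by
  let ρ : Representation ℂ G (G → ℂ) :=
    { toFun := fun g => LinearMap.funLeft ℂ ℂ (fun x => g⁻¹ * x)
      map_one' := by ext; simp [LinearMap.funLeft]
      map_mul' := fun g h => by ext; simp [LinearMap.funLeft, mul_assoc] }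
  convert isChar_character ρ using 1
  ext g
  have : ρ.character g = ∑ x : G, (Pi.single x 1 : G → ℂ) (g⁻¹ * x) := by
    rw [Representation.character, LinearMap.trace_eq_matrix_trace ℂ (Pi.basisFun ℂ G)]
    simp [Matrix.trace, ρ, LinearMap.funLeft]
  rw [this]
  simp [regChar, Pi.single_apply]

open scoped ComplexOrder in
open Matrix in
/-- Every finite matrix group preserves a positive definite Hermitian form, so the trace of an
inverse is the complex conjugate of the trace. -/
theorem IsChar.apply_inv {G : Type*} [Group G] [Finite G] {χ : G → ℂ} (hχ : IsChar G χ) (g : G) :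
    χ g⁻¹ = (starRingEnd ℂ) (χ g) := by
  have := Fintype.ofFinite G
  obtain ⟨n, ρ, hρ⟩ := hχ
  let M : G → Matrix (Fin n) (Fin n) ℂ := fun g => LinearMap.toMatrix' (ρ g)
  have hM : ∀ a b, M (a * b) = M a * M b := fun a b => by
    simp [M, Module.End.mul_eq_comp, LinearMap.toMatrix'_comp]
  have hM1 : M 1 = 1 := by simp [M, Module.End.one_eq_id]
  have htr : ∀ a, χ a = (M a).trace := fun a => by
    rw [hρ, LinearMap.trace_eq_matrix_trace ℂ (Pi.basisFun ℂ (Fin n))]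
    rfl
  let P := ∑ a, (M a)ᴴ * M a
  have hP : P.PosDef := by
    have : P = (M 1)ᴴ * M 1 + ∑ a ∈ Finset.univ.erase 1, (M a)ᴴ * M a := by
      rw [Finset.add_sum_erase _ (fun a => (M a)ᴴ * M a) (Finset.mem_univ _)]
    rw [this, hM1]
    simp only [conjTranspose_one, mul_one]
    exact PosDef.one.add_posSemidef
      (posSemidef_sum _ fun a _ => posSemidef_conjTranspose_mul_self _)
  have hPg : (M g)ᴴ * P = P * M g⁻¹ := by
    have h1 : (M g)ᴴ * P * M g = P := by
      simp only [P, Finset.mul_sum, Finset.sum_mul]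
      refine Fintype.sum_equiv (Equiv.mulRight g) _ _ fun a => ?_
      simp [hM, conjTranspose_mul, Matrix.mul_assoc]
    calc (M g)ᴴ * P = (M g)ᴴ * P * (M g * M g⁻¹) := by rw [← hM]; simp [hM1]
      _ = P * M g⁻¹ := by rw [← Matrix.mul_assoc, h1]
  have hdet := (isUnit_iff_isUnit_det P).mp hP.isUnit
  have : M g⁻¹ = P⁻¹ * ((M g)ᴴ * P) := by
    rw [hPg, ← Matrix.mul_assoc, nonsing_inv_mul _ hdet, Matrix.one_mul]
  rw [htr, htr, this, trace_mul_comm, Matrix.mul_assoc, mul_nonsing_inv _ hdet, Matrix.mul_one,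
    trace_conjTranspose]
  rfl

section charInner

variable {G : Type*} [Group G] [Fintype G]

theorem charInner_add_left (f f' g : G → ℂ) :
    charInner G (f + f') g = charInner G f g + charInner G f' g := by
  simp [charInner, add_mul, Finset.sum_add_distrib, mul_add]

theorem charInner_add_right (f g g' : G → ℂ) :
    charInner G f (g + g') = charInner G f g + charInner G f g' := by
  simp [charInner, Finset.sum_add_distrib, mul_add]

@[simp]
theorem charInner_zero_left (g : G → ℂ) : charInner G 0 g = 0 := by simp [charInner]

theorem charInner_conj (f g : G → ℂ) :
    (starRingEnd ℂ) (charInner G f g) = charInner G g f := by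
  simp [charInner, mul_comm]

theorem charInner_eq_zero_comm {f g : G → ℂ} : charInner G f g = 0 ↔ charInner G g f = 0 := by
  rw [← charInner_conj, map_eq_zero]

open Representation in
theorem charInner_character {V W : Type*} [AddCommGroup V] [Module ℂ V] [FiniteDimensional ℂ V]
    [AddCommGroup W] [Module ℂ W] [FiniteDimensional ℂ W] (ρ : Representation ℂ G V)
    (σ : Representation ℂ G W) :
    charInner G σ.character ρ.character = Module.finrank ℂ (IntertwiningMap ρ σ) := by
  have : Invertible (Nat.card G : ℂ) := invertibleOfNonzero (by simp)
  rw [← card_inv_mul_sum_char_mul_char_eq_finrank, charInner, Nat.card_eq_fintype_card]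
  simp_rw [(isChar_character ρ).apply_inv]

theorem IsChar.exists_nat_charInner {χ ψ : G → ℂ} (hχ : IsChar G χ) (hψ : IsChar G ψ) :
    ∃ n : ℕ, charInner G χ ψ = n := by
  obtain ⟨n, ρ, rfl⟩ := hχ.exists_character_eq
  obtain ⟨m, σ, rfl⟩ := hψ.exists_character_eq
  exact ⟨_, charInner_character σ ρ⟩

theorem charInner_self_eq_zero {f : G → ℂ} (h : charInner G f f = 0) : f = 0 := by
  have h1 : ∑ x : G, Complex.normSq (f x) = 0 := by
    have : (∑ x : G, (Complex.normSq (f x) : ℂ)) = 0 := by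
      simpa [charInner, Complex.mul_conj] using h
    exact_mod_cast this
  ext x
  simpa using (Finset.sum_eq_zero_iff_of_nonneg fun x _ => Complex.normSq_nonneg (f x)).mp h1 x
    (Finset.mem_univ x)

theorem charInner_regChar (f : G → ℂ) : charInner G f (regChar G) = f 1 := by
  have : (Fintype.card G : ℂ) ≠ 0 := by simp
  simp [charInner, regChar, apply_ite]
  field_simp

end charInner

open Representation in
theorem exists_character_add_of_not_irreducible {G V : Type*} [Group G] [Finite G]
    [AddCommGroup V] [Module ℂ V] [FiniteDimensional ℂ V] [Nontrivial V]
    (ρ : Representation ℂ G V) (hρ : ¬ρ.IsIrreducible) :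
    ∃ χ ψ : G → ℂ, IsChar G χ ∧ IsChar G ψ ∧ χ 1 ≠ 0 ∧ ψ 1 ≠ 0 ∧ ρ.character = χ + ψ := by
  have hnt : Nontrivial (Subrepresentation ρ) := by
    refine ⟨⊥, ⊤, fun h => ?_⟩
    exact bot_ne_top (α := Submodule ℂ V) (congrArg Subrepresentation.toSubmodule h)
  obtain ⟨W, hW⟩ : ∃ W : Subrepresentation ρ, ¬(W = ⊥ ∨ W = ⊤) := by
    by_contra! h
    exact hρ { eq_bot_or_eq_top := h }
  rw [not_or] at hW
  have : NeZero (Nat.card G : ℂ) := ⟨Nat.cast_ne_zero.mpr Nat.card_pos.ne'⟩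
  obtain ⟨W', hWW'⟩ := exists_isCompl W
  have hW' : W' ≠ ⊥ := fun h => hW.2 (eq_top_of_isCompl_bot (h ▸ hWW'))
  have hc : IsCompl W.toSubmodule W'.toSubmodule := by
    rw [isCompl_iff, disjoint_iff, codisjoint_iff]
    exact ⟨congrArg Subrepresentation.toSubmodule hWW'.inf_eq_bot,
      congrArg Subrepresentation.toSubmodule hWW'.sup_eq_top⟩
  have hdeg : ∀ U : Subrepresentation ρ, U ≠ ⊥ → U.toRepresentation.character 1 ≠ 0 := by
    intro U hU
    rw [char_one, Nat.cast_ne_zero, Ne, Submodule.finrank_eq_zero]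
    exact fun h => hU (Subrepresentation.toSubmodule_injective h)
  refine ⟨_, _, isChar_character W.toRepresentation, isChar_character W'.toRepresentation,
    hdeg _ hW.1, hdeg _ hW', ?_⟩
  rw [← char_iso (.mk (Submodule.prodEquivOfIsCompl _ _ hc) fun g => ?_ :
    (W.toRepresentation.prod W'.toRepresentation).Equiv ρ)]
  · ext g
    exact LinearMap.trace_prodMap' _ _
  · ext x <;> simp [Representation.prod, Subrepresentation.toRepresentation]

section irreducible

variable {G : Type*} [Group G] [Fintype G]

theorem IsIrrChar.exists_irreducible {χ : G → ℂ} (hχ : IsIrrChar G χ) :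
    ∃ (n : ℕ) (ρ : Representation ℂ G (Fin n → ℂ)), ρ.IsIrreducible ∧ ρ.character = χ := by
  obtain ⟨hc, h1⟩ := hχ
  obtain ⟨n, ρ, rfl⟩ := hc.exists_character_eq
  refine ⟨n, ρ, ?_, rfl⟩
  by_contra hρ
  have : Nontrivial (Fin n → ℂ) := by
    by_contra hn
    rw [not_nontrivial_iff_subsingleton] at hn
    have : ρ.character = 0 := by
      ext g
      simp [Representation.character, Subsingleton.elim (ρ g) 0]
    simp [this] at h1
  obtain ⟨χ, ψ, hχ, hψ, hχ1, hψ1, h⟩ := exists_character_add_of_not_irreducible ρ hρ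
  rw [h, charInner_add_left, charInner_add_right, charInner_add_right] at h1
  obtain ⟨a, ha⟩ := hχ.exists_nat_charInner hχ
  obtain ⟨b, hb⟩ := hχ.exists_nat_charInner hψ
  obtain ⟨c, hc⟩ := hψ.exists_nat_charInner hχ
  obtain ⟨d, hd⟩ := hψ.exists_nat_charInner hψ
  have ha0 : a ≠ 0 := by
    rintro rfl
    exact hχ1 (congrFun (charInner_self_eq_zero (by simpa using ha)) 1)
  have hd0 : d ≠ 0 := by
    rintro rfl
    exact hψ1 (congrFun (charInner_self_eq_zero (by simpa using hd)) 1)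
  rw [ha, hb, hc, hd] at h1
  norm_cast at h1
  omega

theorem isIrrChar_character {V : Type*} [AddCommGroup V] [Module ℂ V] [FiniteDimensional ℂ V]
    (ρ : Representation ℂ G V) [ρ.IsIrreducible] : IsIrrChar G ρ.character :=
  ⟨isChar_character ρ, by simp [charInner_character]⟩

theorem IsIrrChar.charInner_eq_zero {χ ψ : G → ℂ} (hχ : IsIrrChar G χ) (hψ : IsIrrChar G ψ)
    (h : χ ≠ ψ) : charInner G χ ψ = 0 := by
  obtain ⟨n, ρ, hρ, rfl⟩ := hχ.exists_irreducible
  obtain ⟨m, σ, hσ, rfl⟩ := hψ.exists_irreducible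
  have : IsEmpty (σ.Equiv ρ) := ⟨fun e => h (Representation.char_iso e).symm⟩
  simp [charInner_character, Module.finrank_zero_of_subsingleton]

theorem IsIrrChar.apply_one_ne_zero {χ : G → ℂ} (hχ : IsIrrChar G χ) : χ 1 ≠ 0 := by
  intro h
  have := hχ.2
  simp [hχ.1.eq_zero_of_apply_one h] at this

/-- Every character is a sum of irreducible characters. -/
@[elab_as_elim]
theorem IsChar.induction {P : ∀ χ : G → ℂ, IsChar G χ → Prop} (zero : P 0 .zero)
    (irr : ∀ ψ (hψ : IsIrrChar G ψ), P ψ hψ.1)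
    (add : ∀ ψ θ (hψ : IsChar G ψ) (hθ : IsChar G θ), P ψ hψ → P θ hθ → P (ψ + θ) (hψ.add hθ))
    {χ : G → ℂ} (hχ : IsChar G χ) : P χ hχ := by
  obtain ⟨d, hd⟩ := hχ.exists_nat_one
  induction d using Nat.strong_induction_on generalizing χ with
  | _ d ih =>
    obtain ⟨n, ρ, rfl⟩ := hχ.exists_character_eq
    by_cases hρ : ρ.IsIrreducible
    · exact irr _ (isIrrChar_character ρ)
    rcases subsingleton_or_nontrivial (Fin n → ℂ) with hn | hn
    · have : ρ.character = 0 := by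
        ext g
        simp [Representation.character, Subsingleton.elim (ρ g) 0]
      simpa only [this] using zero
    obtain ⟨ψ, θ, hψ, hθ, hψ1, hθ1, h⟩ := exists_character_add_of_not_irreducible ρ hρ
    obtain ⟨a, ha⟩ := hψ.exists_nat_one
    obtain ⟨b, hb⟩ := hθ.exists_nat_one
    rw [ha, Nat.cast_ne_zero] at hψ1
    rw [hb, Nat.cast_ne_zero] at hθ1
    have hab : d = a + b := by
      have h1 := congrFun h 1
      rw [hd, Pi.add_apply, ha, hb] at h1
      exact_mod_cast h1
    simp only [h]
    exact add _ _ hψ hθ (ih a (by omega) hψ ha) (ih b (by omega) hθ hb)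

theorem IsChar.add_charInner_ne_zero {χ χ' ψ : G → ℂ} (hχ : IsChar G χ) (hχ' : IsChar G χ')
    (hψ : IsChar G ψ) (h : charInner G χ ψ ≠ 0) : charInner G (χ + χ') ψ ≠ 0 := by
  obtain ⟨a, ha⟩ := hχ.exists_nat_charInner hψ
  obtain ⟨b, hb⟩ := hχ'.exists_nat_charInner hψ
  rw [ha, Nat.cast_ne_zero] at h
  rw [charInner_add_left, ha, hb]
  norm_cast
  omega

theorem IsChar.exists_irr_add {χ f : G → ℂ} (hχ : IsChar G χ) (h : charInner G χ f ≠ 0) :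
    ∃ ψ θ : G → ℂ, IsIrrChar G ψ ∧ IsChar G θ ∧ χ = ψ + θ ∧ charInner G ψ f ≠ 0 := by
  induction hχ using IsChar.induction with
  | zero => simp at h
  | irr ψ hψ => exact ⟨ψ, 0, hψ, .zero, by simp, h⟩
  | add χ₁ χ₂ h₁ h₂ ih₁ ih₂ =>
    rw [charInner_add_left] at h
    by_cases h0 : charInner G χ₁ f = 0
    · obtain ⟨ψ, θ, hψ, hθ, rfl, hψf⟩ := ih₂ (by simpa [h0] using h)
      exact ⟨ψ, χ₁ + θ, hψ, h₁.add hθ, by abel, hψf⟩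
    · obtain ⟨ψ, θ, hψ, hθ, rfl, hψf⟩ := ih₁ h0
      exact ⟨ψ, θ + χ₂, hψ, hθ.add h₂, by abel, hψf⟩

theorem IsChar.charInner_irr_add_ne_zero {ψ θ : G → ℂ} (hψ : IsIrrChar G ψ) (hθ : IsChar G θ) :
    charInner G (ψ + θ) ψ ≠ 0 :=
  hψ.1.add_charInner_ne_zero hθ hψ.1 (by simp [hψ.2])

theorem IsChar.exists_eq_add {χ ψ : G → ℂ} (hχ : IsChar G χ) (hψ : IsIrrChar G ψ)
    (h : charInner G χ ψ ≠ 0) : ∃ θ, IsChar G θ ∧ χ = ψ + θ := by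
  obtain ⟨ψ', θ, hψ', hθ, rfl, h'⟩ := hχ.exists_irr_add h
  obtain rfl : ψ' = ψ := by_contra fun hne => h' (hψ'.charInner_eq_zero hψ hne)
  exact ⟨θ, hθ, rfl⟩

theorem IsChar.exists_constituent {χ : G → ℂ} (hχ : IsChar G χ) (h : χ ≠ 0) :
    ∃ ψ, IsIrrChar G ψ ∧ charInner G χ ψ ≠ 0 := by
  obtain ⟨ψ, θ, hψ, hθ, rfl, -⟩ := hχ.exists_irr_add (f := χ) fun h0 =>
    h (charInner_self_eq_zero h0)
  exact ⟨ψ, hψ, charInner_irr_add_ne_zero hψ hθ⟩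

theorem IsChar.exists_common_constituent {χ χ' : G → ℂ} (hχ : IsChar G χ)
    (h : charInner G χ χ' ≠ 0) :
    ∃ ψ, IsIrrChar G ψ ∧ charInner G χ ψ ≠ 0 ∧ charInner G χ' ψ ≠ 0 := by
  obtain ⟨ψ, θ, hψ, hθ, rfl, h'⟩ := hχ.exists_irr_add h
  exact ⟨ψ, hψ, charInner_irr_add_ne_zero hψ hθ, mt charInner_eq_zero_comm.mp h'⟩

theorem finite_isIrrChar (G : Type*) [Group G] [Fintype G] :
    {χ : G → ℂ | IsIrrChar G χ}.Finite := by
  have key : ∀ f, IsChar G f → {χ : G → ℂ | IsIrrChar G χ ∧ charInner G f χ ≠ 0}.Finite := by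
    intro f hf
    induction hf using IsChar.induction with
    | zero => simp
    | irr ψ hψ =>
      refine (Set.finite_singleton ψ).subset fun χ hχ => ?_
      exact by_contra fun hne => hχ.2 (hψ.charInner_eq_zero hχ.1 (Ne.symm hne))
    | add ψ θ _ _ ih₁ ih₂ =>
      refine (ih₁.union ih₂).subset fun χ hχ => ?_
      by_cases h0 : charInner G ψ χ = 0
      · exact .inr ⟨hχ.1, by simpa [charInner_add_left, h0] using hχ.2⟩
      · exact .inl ⟨hχ.1, h0⟩
  refine (key _ (isChar_regChar G)).subset fun χ hχ => ⟨hχ, ?_⟩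
  rw [Ne, charInner_eq_zero_comm, charInner_regChar]
  exact IsIrrChar.apply_one_ne_zero hχ

end irreducible

section restriction

variable {G : Type*} [Group G] [Fintype G]

theorem sum_inclusion {L H : Subgroup G} (h : L ≤ H) {M : Type*} [AddCommMonoid M] (f : H → M) :
    ∑ l : L, f (Subgroup.inclusion h l) = ∑ x : H, if (x : G) ∈ L then f x else 0 := by
  refine Fintype.sum_of_injective _ (Subgroup.inclusion_injective h) _ _ (fun x hx => ?_)
    fun l => by simp
  rw [if_neg]
  exact fun hxL => hx ⟨⟨x, hxL⟩, rfl⟩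

theorem charInner_resChar_regChar {L H : Subgroup G} (h : L ≤ H) (f : L → ℂ) :
    charInner L f (resChar h (regChar H)) =
      (Fintype.card L : ℂ)⁻¹ * (Fintype.card H * f 1) := by
  have : ∀ l : L, Subgroup.inclusion h l = 1 ↔ l = 1 := fun l => by
    rw [← Subgroup.inclusion_inj h, map_one]
  simp [charInner, resChar, regChar, apply_ite, this, mul_comm]

/-- The squared norms of a summand `F` of the regular character over `L` and over `H` agree if
`F` is orthogonal to its complement over both groups, so such an `F` is supported on `L`. -/
theorem eq_zero_of_charInner_resChar_eq_zero {L H : Subgroup G} (h : L ≤ H) {F F' : H → ℂ}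
    (hF : regChar H = F + F') (hH : charInner H F F' = 0)
    (hL : charInner L (resChar h F) (resChar h F') = 0) {x : H} (hx : (x : G) ∉ L) : F x = 0 := by
  have key : ∀ (K : Subgroup G) (hK : K ≤ H), charInner K (resChar hK F) (resChar hK F') = 0 →
      ∑ k : K, Complex.normSq (F (Subgroup.inclusion hK k)) = (Fintype.card H * F 1).re := by
    intro K hK h0
    have h1 := charInner_resChar_regChar hK (resChar hK F)
    rw [hF, resChar_add,
      charInner_add_right, h0, add_zero, charInner,
      mul_right_inj' (inv_ne_zero (Nat.cast_ne_zero.mpr Fintype.card_ne_zero))] at h1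
    simp only [resChar, Complex.mul_conj, map_one] at h1
    rw [← h1]
    simp
  have hsum : ∑ y : H, (if (y : G) ∈ L then 0 else Complex.normSq (F y)) = 0 := by
    have h1 := (key H le_rfl hH).trans (key L h hL).symm
    rw [sum_inclusion h fun y => Complex.normSq (F y),
      sum_inclusion le_rfl fun y => Complex.normSq (F y), ← sub_eq_zero,
      ← Finset.sum_sub_distrib] at h1
    rw [← h1]
    refine Finset.sum_congr rfl fun y _ => ?_
    split_ifs <;> simp_all
  have hnn : ∀ y ∈ Finset.univ, 0 ≤ (if ((y : H) : G) ∈ L then 0 else Complex.normSq (F y)) :=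
    fun y _ => by split_ifs <;> simp [Complex.normSq_nonneg]
  simpa [hx] using (Finset.sum_eq_zero_iff_of_nonneg hnn).mp hsum x (Finset.mem_univ x)

theorem exists_mem_of_charInner_resChar_ne_zero {L H : Subgroup G} (h : L ≤ H) {C : Set (H → ℂ)}
    {F : H → ℂ} (hF : F ∈ AddSubmonoid.closure C) {g : L → ℂ}
    (hg : charInner L (resChar h F) g ≠ 0) : ∃ χ ∈ C, charInner L (resChar h χ) g ≠ 0 := by
  induction hF using AddSubmonoid.closure_induction with
  | mem χ hχ => exact ⟨χ, hχ, hg⟩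
  | zero => exact absurd (charInner_zero_left _) hg
  | add f f' _ _ ih ih' =>
    rw [resChar_add, charInner_add_left] at hg
    by_cases h0 : charInner L (resChar h f) g = 0
    · exact ih' (by simpa [h0] using hg)
    · exact ih h0

theorem IsChar.mem_closure {G : Type*} [Group G] [Fintype G] {f : G → ℂ} (hf : IsChar G f) :
    f ∈ AddSubmonoid.closure {χ : G → ℂ | IsIrrChar G χ} := by
  induction hf using IsChar.induction with
  | zero => exact zero_mem _
  | irr ψ hψ => exact AddSubmonoid.subset_closure hψ
  | add _ _ _ _ h₁ h₂ => exact add_mem h₁ h₂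

theorem IsChar.of_mem_closure {G : Type*} [Group G] {C : Set (G → ℂ)}
    (hC : ∀ χ ∈ C, IsChar G χ) {f : G → ℂ} (hf : f ∈ AddSubmonoid.closure C) : IsChar G f := by
  induction hf using AddSubmonoid.closure_induction with
  | mem χ hχ => exact hC χ hχ
  | zero => exact .zero
  | add _ _ _ _ h₁ h₂ => exact h₁.add h₂

theorem charInner_resChar_eq_zero_of_mem_closure {L H : Subgroup G} (h : L ≤ H)
    {C C' : Set (H → ℂ)}
    (hC : ∀ χ ∈ C, ∀ χ' ∈ C', charInner L (resChar h χ) (resChar h χ') = 0) {F F' : H → ℂ}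
    (hF : F ∈ AddSubmonoid.closure C) (hF' : F' ∈ AddSubmonoid.closure C') :
    charInner L (resChar h F) (resChar h F') = 0 := by
  by_contra h0
  obtain ⟨χ, hχ, h1⟩ := exists_mem_of_charInner_resChar_ne_zero h hF h0
  rw [Ne, charInner_eq_zero_comm] at h1
  obtain ⟨χ', hχ', h2⟩ := exists_mem_of_charInner_resChar_ne_zero h hF' h1
  exact h2 (charInner_eq_zero_comm.mp (hC χ hχ χ' hχ'))

/-- Every irreducible character of `L` lies under an irreducible character of `H ≥ L`. -/
theorem IsIrrChar.exists_over {L H : Subgroup G} (h : L ≤ H) {α : L → ℂ} (hα : IsIrrChar L α) :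
    ∃ χ, IsIrrChar H χ ∧ charInner L (resChar h χ) α ≠ 0 := by
  refine exists_mem_of_charInner_resChar_ne_zero h (isChar_regChar H).mem_closure ?_
  rw [Ne, charInner_eq_zero_comm, charInner_resChar_regChar]
  simp [hα.apply_one_ne_zero]

/-- Every irreducible character of `H` lies over an irreducible character of `L ≤ H`. -/
theorem IsIrrChar.exists_under {L H : Subgroup G} (h : L ≤ H) {χ : H → ℂ} (hχ : IsIrrChar H χ) :
    ∃ α, IsIrrChar L α ∧ charInner L (resChar h χ) α ≠ 0 := by
  refine (hχ.1.resChar h).exists_constituent fun h0 => hχ.apply_one_ne_zero ?_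
  simpa [resChar] using congrFun h0 1

end restriction

section components

variable {p e : ℕ} {G : Type*} [Group G] [Fintype G]

/-- If a union of connected components contains `(L, α)` but not `(L, α')`, then `α` and `α'` have
no common constituent over `I`: the part of the regular character of `G` that lies in the union is
supported on every subgroup of order `p ^ (e + 1)`, hence on `I`. -/
theorem charInner_resChar_iInf_eq_zero {I : Subgroup G}
    (hI : I = ⨅ (H : Subgroup G) (_ : Fintype.card H = p ^ (e + 1)), H)
    {P : GammaPair p e G → Prop} (hP : ∀ a b, GammaLe a b → (P a ↔ P b))
    {L : Subgroup G} (hL : Fintype.card L = p ^ (e + 1)) (hIL : I ≤ L)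
    {α α' : L → ℂ} (hα : IsIrrChar L α) (hα' : IsIrrChar L α')
    (hPα : P ⟨L, hL.ge, α, hα⟩) (hPα' : ¬P ⟨L, hL.ge, α', hα'⟩) :
    charInner I (resChar hIL α) (resChar hIL α') = 0 := by
  obtain ⟨T, hle⟩ : ∃ T : Subgroup G, ∀ K, K ≤ T := ⟨⊤, fun _ => le_top⟩
  have hT : p ^ (e + 1) ≤ Fintype.card T := by
    rw [← hL]
    exact Fintype.card_le_of_injective _ (Subgroup.inclusion_injective (hle L))
  let C : Set (T → ℂ) := {χ | ∃ hχ, P ⟨T, hT, χ, hχ⟩}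
  let C' : Set (T → ℂ) := {χ | ∃ hχ, ¬P ⟨T, hT, χ, hχ⟩}
  obtain ⟨F, hF, F', hF', hFF'⟩ : ∃ F ∈ AddSubmonoid.closure C, ∃ F' ∈ AddSubmonoid.closure C',
      F + F' = regChar T := by
    rw [← AddSubmonoid.mem_sup]
    generalize regChar T = f, isChar_regChar T = hf
    induction hf using IsChar.induction with
    | zero => exact zero_mem _
    | irr ψ hψ =>
      by_cases h : P ⟨T, hT, ψ, hψ⟩
      · exact AddSubmonoid.mem_sup_left (AddSubmonoid.subset_closure ⟨hψ, h⟩)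
      · exact AddSubmonoid.mem_sup_right (AddSubmonoid.subset_closure ⟨hψ, h⟩)
    | add _ _ _ _ h₁ h₂ => exact add_mem h₁ h₂
  have hFc := IsChar.of_mem_closure (fun χ hχ => hχ.1.1) hF
  have hFc' := IsChar.of_mem_closure (fun χ hχ => hχ.1.1) hF'
  have hdisj : ∀ K : Subgroup G, p ^ (e + 1) ≤ Fintype.card K →
      charInner K (resChar (hle _) F) (resChar (hle _) F') = 0 := by
    refine fun K hK => charInner_resChar_eq_zero_of_mem_closure (hle _) ?_ hF hF'
    rintro χ ⟨hχ, hPχ⟩ χ' ⟨hχ', hPχ'⟩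
    by_contra h0
    obtain ⟨ψ, hψ, h₁, h₂⟩ := (hχ.1.resChar (hle _)).exists_common_constituent h0
    exact hPχ' ((hP ⟨K, hK, ψ, hψ⟩ ⟨T, hT, χ', hχ'⟩ ⟨hle _, h₂⟩).mp
      ((hP ⟨K, hK, ψ, hψ⟩ ⟨T, hT, χ, hχ⟩ ⟨hle _, h₁⟩).mpr hPχ))
  have hsupp : ∀ x : T, (x : G) ∉ I → F x = 0 := by
    intro x hx
    simp only [hI, Subgroup.mem_iInf, not_forall] at hx
    obtain ⟨K, hK, hxK⟩ := hx
    exact eq_zero_of_charInner_resChar_eq_zero (hle _) hFF'.symm (hdisj T hT) (hdisj K hK.ge) hxK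
  have hFI : charInner I (resChar (hle _) F) (resChar (hle _) F') = 0 := by
    rw [← mul_zero ((Fintype.card I : ℂ)⁻¹ * Fintype.card T), ← hdisj T hT]
    simp only [charInner, resChar]
    rw [sum_inclusion (hle _) fun x => F x * (starRingEnd ℂ) (F' x),
      sum_inclusion (hle _) fun x => F x * (starRingEnd ℂ) (F' x), mul_assoc,
      mul_inv_cancel_left₀ (Nat.cast_ne_zero.mpr Fintype.card_ne_zero)]
    congr 1
    refine Finset.sum_congr rfl fun x _ => ?_
    by_cases hx : (x : G) ∈ I
    · simp [hx]
    · simp [hsupp x hx]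
  have hreg : ∀ β, IsIrrChar L β →
      charInner L (resChar (hle _) F) β ≠ 0 ∨ charInner L (resChar (hle _) F') β ≠ 0 := by
    intro β hβ
    by_contra! h0
    have h1 : charInner L (resChar (hle _) (F + F')) β = 0 := by
      rw [resChar_add, charInner_add_left, h0.1, h0.2, add_zero]
    rw [hFF', charInner_eq_zero_comm, charInner_resChar_regChar] at h1
    simp [hβ.apply_one_ne_zero] at h1
  have hFα := (hreg α hα).resolve_right fun h0 => by
    obtain ⟨χ, ⟨hχ, hPχ⟩, h1⟩ := exists_mem_of_charInner_resChar_ne_zero (hle _) hF' h0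
    exact hPχ ((hP ⟨L, hL.ge, α, hα⟩ ⟨T, hT, χ, hχ⟩ ⟨hle _, h1⟩).mp hPα)
  have hFα' := (hreg α' hα').resolve_left fun h0 => by
    obtain ⟨χ, ⟨hχ, hPχ⟩, h1⟩ := exists_mem_of_charInner_resChar_ne_zero (hle _) hF h0
    exact hPα' ((hP ⟨L, hL.ge, α', hα'⟩ ⟨T, hT, χ, hχ⟩ ⟨hle _, h1⟩).mpr hPχ)
  obtain ⟨θ, hθ, hFθ⟩ := (hFc.resChar (hle _)).exists_eq_add hα hFα
  obtain ⟨θ', hθ', hFθ'⟩ := (hFc'.resChar (hle _)).exists_eq_add hα' hFα'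
  change charInner I (resChar hIL (resChar (hle _) F)) (resChar hIL (resChar (hle _) F')) = 0 at hFI
  rw [hFθ, hFθ', resChar_add, resChar_add] at hFI
  by_contra h0
  refine (hα.1.resChar hIL).add_charInner_ne_zero (hθ.resChar hIL)
    ((hα'.1.add hθ').resChar hIL) ?_ hFI
  rw [charInner_eq_zero_comm] at h0
  rw [Ne, charInner_eq_zero_comm]
  exact (hα'.1.resChar hIL).add_charInner_ne_zero (hθ'.resChar hIL) (hα.1.resChar hIL) h0

theorem exists_connected_of_subgroup {L : Subgroup G} (hL : p ^ (e + 1) ≤ Fintype.card L)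
    (a : GammaPair p e G) :
    ∃ (α : L → ℂ) (hα : IsIrrChar L α), GammaConnected ⟨L, hL, α, hα⟩ a := by
  obtain ⟨T, hle⟩ : ∃ T : Subgroup G, ∀ K, K ≤ T := ⟨⊤, fun _ => le_top⟩
  have hT : p ^ (e + 1) ≤ Fintype.card T :=
    hL.trans (Fintype.card_le_of_injective _ (Subgroup.inclusion_injective (hle L)))
  obtain ⟨χ, hχ, h₁⟩ := a.hφ.exists_over (hle a.H)
  obtain ⟨α, hα, h₂⟩ := hχ.exists_under (hle L)
  let b : GammaPair p e G := ⟨T, hT, χ, hχ⟩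
  have hb : GammaLe ⟨L, hL, α, hα⟩ b := ⟨hle L, h₂⟩
  have hab : GammaLe a b := ⟨hle a.H, h₁⟩
  exact ⟨α, hα, Relation.EqvGen.trans _ b _ (.rel _ _ (.inl hb)) (.rel _ _ (.inr hab))⟩

end components

/-- `|π₀(Γ_{p,e}(G))| ≤ |Irr(I)|` where `I` is the intersection of
all subgroups of order `p^(e+1)`; in particular two irreducible characters of a
fixed subgroup `L₀` of order `p^(e+1)` whose restrictions to `I` share a common
irreducible constituent give connected pairs. -/
theorem components_le_card_irr_of_intersection {p e : ℕ} (hp : p.Prime)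
    {G : Type*} [Group G] [Fintype G] (hG : IsPGroup p G)
    (hdvd : p ^ (e + 1) ∣ Fintype.card G)
    (I : Subgroup G)
    (hI : I = ⨅ (H : Subgroup G) (_ : Fintype.card H = p ^ (e + 1)), H) :
    Nat.card (Quotient (gammaSetoid p e G)) ≤
        Nat.card {χ : I → ℂ // IsIrrChar I χ} ∧
      ∀ (L0 : Subgroup G) (hL0 : Fintype.card L0 = p ^ (e + 1))
        (α α' : L0 → ℂ) (hα : IsIrrChar L0 α) (hα' : IsIrrChar L0 α'),
        charInner I (resChar (hI ▸ iInf₂_le L0 hL0) α)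
            (resChar (hI ▸ iInf₂_le L0 hL0) α') ≠ 0 →
        GammaConnected ⟨L0, le_of_eq hL0.symm, α, hα⟩
          ⟨L0, le_of_eq hL0.symm, α', hα'⟩ := by
  have hconn : ∀ (L0 : Subgroup G) (hL0 : Fintype.card L0 = p ^ (e + 1))
      (hIL : I ≤ L0) (α α' : L0 → ℂ) (hα : IsIrrChar L0 α) (hα' : IsIrrChar L0 α'),
      charInner I (resChar hIL α) (resChar hIL α') ≠ 0 →
      GammaConnected (p := p) (e := e) ⟨L0, le_of_eq hL0.symm, α, hα⟩
        ⟨L0, le_of_eq hL0.symm, α', hα'⟩ := by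
    intro L0 hL0 hIL α α' hα hα' h0
    by_contra hne
    refine h0 (charInner_resChar_iInf_eq_zero hI
      (P := GammaConnected ⟨L0, le_of_eq hL0.symm, α, hα⟩) (fun a b hab => ?_) hL0 hIL hα hα'
      (.refl _) hne)
    have : GammaConnected a b := .rel _ _ (.inl hab)
    exact ⟨fun h => .trans _ _ _ h this, fun h => .trans _ _ _ h (.symm _ _ this)⟩
  refine ⟨?_, fun L0 hL0 α α' hα hα' h0 => hconn L0 hL0 _ α α' hα hα' h0⟩
  have : Fact p.Prime := ⟨hp⟩
  obtain ⟨L, hL⟩ := Sylow.exists_subgroup_card_pow_prime (G := G) p (n := e + 1)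
    (by rwa [Nat.card_eq_fintype_card])
  rw [Nat.card_eq_fintype_card] at hL
  have hIL : I ≤ L := hI ▸ iInf₂_le L hL
  have hrep : ∀ q : Quotient (gammaSetoid p e G), ∃ (α : L → ℂ) (hα : IsIrrChar L α)
      (β : {χ : I → ℂ // IsIrrChar I χ}), Quotient.mk _ ⟨L, hL.ge, α, hα⟩ = q ∧
        charInner I (resChar hIL α) β ≠ 0 := by
    intro q
    induction q using Quotient.inductionOn with
    | h a =>
      obtain ⟨α, hα, hαa⟩ := exists_connected_of_subgroup hL.ge a
      obtain ⟨β, hβ, h0⟩ := hα.exists_under hIL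
      exact ⟨α, hα, ⟨β, hβ⟩, Quotient.sound hαa, h0⟩
  choose α hα β hq hβ using hrep
  have : Finite {χ : I → ℂ // IsIrrChar I χ} := finite_isIrrChar I
  refine Nat.card_le_card_of_injective β fun q q' hqq' => ?_
  rw [← hq q, ← hq q']
  refine Quotient.sound (hconn L hL hIL _ _ _ _ ?_)
  obtain ⟨θ, hθ, hαθ⟩ := ((hα q).1.resChar hIL).exists_eq_add (β q).2 (hβ q)
  rw [hαθ]
  refine (β q).2.1.add_charInner_ne_zero hθ ((hα q').1.resChar hIL) ?_
  rw [Ne, charInner_eq_zero_comm, hqq']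
  exact hβ q'
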